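/- (i) For every quantitative algebra 𝒜 = (A, Ω, d), the first-order structure on A with relations defined by a =_ε b iff d(a,b) ≤ ε (for each ε ∈ ℚ≥0) is a quantitative first-order structure, i.e., it satisfies axioms (1)–(6). (ii) Conversely, for every quantitative first-order structure ℳ = (M, Ω^ℳ, (=_ε^ℳ)_ε), the function d(m,n) = inf{ε ∈ ℚ≥0 | m =_ε n} is a metric on M (with values in [0,∞]) making all operations non-expansive, so (M, Ω^ℳ, d) is a quantitative algebra. These two constructions are mutually inverse, and a map between carriers is a homomorphism of quantitative algebras iff it is a morphism of the associated quantitative first-order structures; hence they define an isomorphism between the category of Ω-quantitative algebras and the category of Ω-quantitative first-order structures. -/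

import Mathlib

open scoped ENNReal NNReal NNRat

/-- An algebraic signature whose operation symbols all have finite arity. -/
structure Sig where
  Op : Type
  arity : Op → Type
  arity_finite : ∀ o, Finite (arity o)

/-- A quantitative algebra over the signature `S`: an `Ω`-algebra together with a
metric with values in `[0,∞]` making every operation non-expansive. -/
structure QA (S : Sig) where
  carrier : Type
  ops : ∀ o : S.Op, (S.arity o → carrier) → carrier
  dist : carrier → carrier → ℝ≥0∞
  dist_self : ∀ a, dist a a = 0
  eq_of_dist_eq_zero : ∀ a b, dist a b = 0 → a = b
  dist_symm : ∀ a b, dist a b = dist b a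
  dist_triangle : ∀ a b c, dist a c ≤ dist a b + dist b c
  nonexpansive : ∀ (o : S.Op) (a b : S.arity o → carrier) (ε : ℝ≥0∞),
    (∀ i, dist (a i) (b i) ≤ ε) → dist (ops o a) (ops o b) ≤ ε

/-- The axioms (1)–(6) of an `Ω`-quantitative first-order structure, for a carrier `M`
with operations `ops` and a family of binary relations `r ε` (one for each `ε ∈ ℚ≥0`):
(1) `=_0` is the identity; (2) each `=_ε` is symmetric; (3) `=_ε ∘ =_δ ⊆ =_{ε+δ}`;
(4) `=_ε ⊆ =_{ε+δ}`; (5) the operations preserve each `=_ε`;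
(6) `⋂_{ε>δ} =_ε ⊆ =_δ`. -/
def IsQFO {S : Sig} {M : Type} (ops : ∀ o : S.Op, (S.arity o → M) → M)
    (r : ℚ≥0 → M → M → Prop) : Prop :=
  (∀ a b, r 0 a b ↔ a = b) ∧
  (∀ (ε : ℚ≥0) a b, r ε a b → r ε b a) ∧
  (∀ (ε δ : ℚ≥0) a b c, r ε a b → r δ b c → r (ε + δ) a c) ∧
  (∀ (ε δ : ℚ≥0) a b, r ε a b → r (ε + δ) a b) ∧
  (∀ (ε : ℚ≥0) (o : S.Op) (a b : S.arity o → M),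
    (∀ i, r ε (a i) (b i)) → r ε (ops o a) (ops o b)) ∧
  (∀ (δ : ℚ≥0) a b, (∀ ε : ℚ≥0, δ < ε → r ε a b) → r δ a b)

/-- The metric axioms of a quantitative algebra, for a carrier `M` with operations
`ops` and a candidate distance `d`. -/
def IsQADist {S : Sig} {M : Type} (ops : ∀ o : S.Op, (S.arity o → M) → M)
    (d : M → M → ℝ≥0∞) : Prop :=
  (∀ a, d a a = 0) ∧
  (∀ a b, d a b = 0 → a = b) ∧
  (∀ a b, d a b = d b a) ∧
  (∀ a b c, d a c ≤ d a b + d b c) ∧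
  (∀ (o : S.Op) (a b : S.arity o → M) (ε : ℝ≥0∞),
    (∀ i, d (a i) (b i) ≤ ε) → d (ops o a) (ops o b) ≤ ε)

/-- The distance associated to a family of relations: `d(m,n) = inf{ε ∈ ℚ≥0 | m =_ε n}`. -/
noncomputable def infDist {M : Type} (r : ℚ≥0 → M → M → Prop) (m n : M) : ℝ≥0∞ :=
  ⨅ (ε : ℚ≥0) (_ : r ε m n), ((ε : ℝ≥0) : ℝ≥0∞)

/-- A bundled `Ω`-quantitative first-order structure. -/
structure QFO (S : Sig) where
  carrier : Type
  ops : ∀ o : S.Op, (S.arity o → carrier) → carrier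
  rel : ℚ≥0 → carrier → carrier → Prop
  isQFO : IsQFO ops rel

/-- The term algebra over the signature `S` and variables `X`. -/
inductive Term (S : Sig) (X : Type) : Type
  | var : X → Term S X
  | op : (o : S.Op) → (S.arity o → Term S X) → Term S X

/-- Evaluation of terms in any `Ω`-algebra structure on `M` under a valuation of the
variables. -/
def evalT {S : Sig} {X M : Type} (ops : ∀ o : S.Op, (S.arity o → M) → M)
    (α : X → M) : Term S X → M
  | .var x => α x
  | .op o args => ops o fun i => evalT ops α (args i)
/-- The nonnegative rationals are order-dense in `[0,∞]`. -/
theorem ENNReal.exists_nnrat_btwn {x y : ℝ≥0∞} (h : x < y) :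
    ∃ q : ℚ≥0, x < ((q : ℝ≥0) : ℝ≥0∞) ∧ ((q : ℝ≥0) : ℝ≥0∞) < y := by
  obtain ⟨q, hq, hxq, hqy⟩ := ENNReal.lt_iff_exists_rat_btwn.1 h
  lift q to ℚ≥0 using hq
  have hcast : Real.toNNReal ((q : ℚ) : ℝ) = (q : ℝ≥0) := by
    ext
    rw [Rat.cast_nnratCast, Real.coe_toNNReal _ (NNRat.cast_nonneg q)]
    rfl
  rw [hcast] at hxq hqy
  exact ⟨q, hxq, hqy⟩

/-- If every nonnegative rational upper bound of `x` is also an upper bound of `y`, then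
`y ≤ x`. -/
theorem ENNReal.le_of_forall_le_nnrat {x y : ℝ≥0∞}
    (h : ∀ q : ℚ≥0, x ≤ ((q : ℝ≥0) : ℝ≥0∞) → y ≤ ((q : ℝ≥0) : ℝ≥0∞)) : y ≤ x := by
  by_contra! hlt
  obtain ⟨q, hxq, hqy⟩ := ENNReal.exists_nnrat_btwn hlt
  exact (h q hxq.le).not_gt hqy

theorem infDist_le {M : Type} {r : ℚ≥0 → M → M → Prop} {m n : M} {q : ℚ≥0}
    (h : r q m n) : infDist r m n ≤ ((q : ℝ≥0) : ℝ≥0∞) :=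
  iInf₂_le q h

theorem infDist_of_dist {M : Type} (d : M → M → ℝ≥0∞) (a b : M) :
    infDist (fun (ε : ℚ≥0) x y => d x y ≤ ((ε : ℝ≥0) : ℝ≥0∞)) a b = d a b :=
  le_antisymm (ENNReal.le_of_forall_le_nnrat fun q h => iInf₂_le q h) (le_iInf₂ fun _ h => h)

namespace IsQFO

variable {S : Sig} {M : Type} {ops : ∀ o : S.Op, (S.arity o → M) → M}
  {r : ℚ≥0 → M → M → Prop}

theorem mono (h : IsQFO ops r) {ε δ : ℚ≥0} (hle : ε ≤ δ) {a b : M} (hr : r ε a b) :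
    r δ a b := by
  obtain ⟨_, _, _, hadd, _, _⟩ := h
  simpa [add_tsub_cancel_of_le hle] using hadd ε (δ - ε) a b hr

theorem infDist_le_iff (h : IsQFO ops r) (ε : ℚ≥0) (m n : M) :
    infDist r m n ≤ ((ε : ℝ≥0) : ℝ≥0∞) ↔ r ε m n := by
  refine ⟨fun hle => ?_, infDist_le⟩
  refine h.2.2.2.2.2 ε m n fun δ hδ => ?_
  have hlt : infDist r m n < ((δ : ℝ≥0) : ℝ≥0∞) := hle.trans_lt (by exact_mod_cast hδ)
  obtain ⟨q, hq, hqδ⟩ : ∃ q, ∃ _ : r q m n, ((q : ℝ≥0) : ℝ≥0∞) < ((δ : ℝ≥0) : ℝ≥0∞) := by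
    simpa only [infDist, iInf_lt_iff] using hlt
  exact h.mono (by exact_mod_cast hqδ.le) hq

theorem isQADist_infDist (h : IsQFO ops r) : IsQADist ops (infDist r) := by
  have hiff := h.infDist_le_iff
  obtain ⟨hrefl, hsymm, htrans, -, hops, -⟩ := h
  have hzero : ∀ a b, infDist r a b = 0 ↔ a = b := fun a b => by
    simpa [hrefl] using hiff 0 a b
  have hsymm_le : ∀ a b, infDist r a b ≤ infDist r b a := fun a b =>
    le_iInf₂ fun q hq => infDist_le (hsymm q b a hq)
  refine ⟨fun a => (hzero a a).2 rfl, fun a b => (hzero a b).1,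
    fun a b => le_antisymm (hsymm_le a b) (hsymm_le b a), fun a b c => ?_,
    fun o a b ε hε => ?_⟩
  · simp only [infDist, ENNReal.iInf_add, ENNReal.add_iInf]
    refine le_iInf₂ fun q hq => le_iInf₂ fun p hp => ?_
    simpa [infDist] using infDist_le (htrans p q a b c hp hq)
  · exact ENNReal.le_of_forall_le_nnrat fun q hq =>
      infDist_le (hops q o a b fun i => (hiff q _ _).1 ((hε i).trans hq))

end IsQFO

theorem QA.isQFO {S : Sig} (A : QA S) :
    IsQFO A.ops fun (ε : ℚ≥0) a b => A.dist a b ≤ ((ε : ℝ≥0) : ℝ≥0∞) := by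
  refine ⟨fun a b => ⟨fun h => A.eq_of_dist_eq_zero a b (by simpa using h), ?_⟩,
    fun ε a b h => (A.dist_symm b a).trans_le h, fun ε δ a b c hab hbc => ?_,
    fun ε δ a b h => h.trans ?_, fun ε o a b h => A.nonexpansive o a b _ h,
    fun δ a b h => ENNReal.le_of_forall_le_nnrat fun q hq => ?_⟩
  · rintro rfl
    simp [A.dist_self]
  · push_cast
    exact (A.dist_triangle a b c).trans (add_le_add hab hbc)
  · push_cast
    exact le_self_add
  · obtain hlt | rfl := (show δ ≤ q by exact_mod_cast hq).lt_or_eq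
    · exact h q hlt
    · refine le_of_forall_gt fun x hx => ?_
      obtain ⟨p, hp, hpx⟩ := ENNReal.exists_nnrat_btwn hx
      exact (h p (by exact_mod_cast hp)).trans_lt hpx

/-- The isomorphism between quantitative algebras and quantitative first-order
structures: (i) the relations `a =_ε b ↔ d(a,b) ≤ ε` of a quantitative algebra satisfy
axioms (1)–(6); (ii) conversely, `d(m,n) = inf{ε | m =_ε n}` of a quantitative
first-order structure is a metric making all operations non-expansive; (iii) the two
constructions are mutually inverse; and (iv) a map is a homomorphism of quantitative
algebras iff it is a morphism of the associated first-order structures (an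
`Ω`-homomorphism preserving every relation `=_ε`). -/
theorem qa_qfo_iso {S : Sig} :
    (∀ A : QA S, IsQFO A.ops fun (ε : ℚ≥0) a b => A.dist a b ≤ ((ε : ℝ≥0) : ℝ≥0∞)) ∧
    (∀ (M : Type) (ops : ∀ o : S.Op, (S.arity o → M) → M) (r : ℚ≥0 → M → M → Prop),
      IsQFO ops r → IsQADist ops (infDist r)) ∧
    (∀ (A : QA S) (a b : A.carrier),
      infDist (fun (ε : ℚ≥0) x y => A.dist x y ≤ ((ε : ℝ≥0) : ℝ≥0∞)) a b = A.dist a b) ∧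
    (∀ (M : Type) (ops : ∀ o : S.Op, (S.arity o → M) → M) (r : ℚ≥0 → M → M → Prop),
      IsQFO ops r → ∀ (ε : ℚ≥0) (m n : M),
        (infDist r m n ≤ ((ε : ℝ≥0) : ℝ≥0∞) ↔ r ε m n)) ∧
    (∀ (A B : QA S) (f : A.carrier → B.carrier),
      ((∀ (o : S.Op) (args : S.arity o → A.carrier),
          f (A.ops o args) = B.ops o fun i => f (args i)) ∧
        ∀ a b, B.dist (f a) (f b) ≤ A.dist a b) ↔
      ((∀ (o : S.Op) (args : S.arity o → A.carrier),
          f (A.ops o args) = B.ops o fun i => f (args i)) ∧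
        ∀ (ε : ℚ≥0) (a b : A.carrier), A.dist a b ≤ ((ε : ℝ≥0) : ℝ≥0∞) →
          B.dist (f a) (f b) ≤ ((ε : ℝ≥0) : ℝ≥0∞))) := by
  exact ⟨QA.isQFO, fun _ _ _ => IsQFO.isQADist_infDist, fun A => infDist_of_dist A.dist,
    fun _ _ _ => IsQFO.infDist_le_iff, fun A B f =>
      and_congr_right fun _ => ⟨fun h _ a b => (h a b).trans,
        fun h a b => ENNReal.le_of_forall_le_nnrat fun q => h q a b⟩⟩
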